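/- arXiv:1812.08965 — 3 statements merged into one kernel-verified Lean document; each statement's English description precedes it below -/
import Mathlib

section
/- (FDR consistency is determined by the nulls.) Let 𝒫 be a class of p-value distribution elements and, for each P ∈ 𝒫, let P_0 be the induced distribution of the null subvector (p_i)_{i∈N_0(P)}, regarded as a p-value distribution element in which all coordinates are null; let 𝒫_0 = {P_0 : P ∈ 𝒫}. If 𝒫_0 is FDR-consistent, then 𝒫 is FDR-consistent. -/
open MeasureTheory Finset

attribute [local instance] Classical.propDecidable

/-- Number of rejections of the Benjamini–Hochberg (step-up) procedure at level `α`
applied to the family of p-values `p` indexed by `ι`: the largest `j` such that the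
`j`-th smallest p-value is at most `α j / n` (equivalently, at least `j` of the
p-values are at most `α j / n`), and `0` if there is no such `j ≥ 1`. -/
noncomputable def bhNumRejections {ι : Type*} [Fintype ι] (α : ℝ) (p : ι → ℝ) : ℕ :=
  Nat.findGreatest
    (fun j => j ≤ (Finset.univ.filter (fun i => p i ≤ α * (j : ℝ) / (Fintype.card ι : ℝ))).card)
    (Fintype.card ι)

/-- False discovery proportion `V / max{R, 1}` of the BH procedure at level `α`
with set of true null hypotheses `N₀`. -/
noncomputable def bhFDP {ι : Type*} [Fintype ι] (α : ℝ) (N₀ : Finset ι) (p : ι → ℝ) : ℝ :=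
  ((N₀.filter (fun i => p i ≤ α * (bhNumRejections α p : ℝ) / (Fintype.card ι : ℝ))).card : ℝ) /
    ((max (bhNumRejections α p) 1 : ℕ) : ℝ)

/-- False discovery rate (expected FDP) of the BH procedure at level `α`. -/
noncomputable def bhFDR {Ω : Type*} [MeasurableSpace Ω] {ι : Type*} [Fintype ι]
    (μ : Measure Ω) (α : ℝ) (N₀ : Finset ι) (p : ι → Ω → ℝ) : ℝ :=
  ∫ ω, bhFDP α N₀ (fun i => p i ω) ∂μ

/-- A p-value distribution element: `n` p-values taking values in `[0,1]` on a
probability space, together with a set `N₀` of true nulls whose p-values are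
super-uniform. -/
structure PValueModel where
  (n : ℕ)
  (Ω : Type)
  [mΩ : MeasurableSpace Ω]
  (μ : Measure Ω)
  (prob : IsProbabilityMeasure μ)
  (p : Fin n → Ω → ℝ)
  (meas : ∀ i, Measurable (p i))
  (range : ∀ i ω, p i ω ∈ Set.Icc (0:ℝ) 1)
  (N₀ : Finset (Fin n))
  (superuniform : ∀ i ∈ N₀, ∀ t ∈ Set.Icc (0:ℝ) 1, μ {ω | p i ω ≤ t} ≤ ENNReal.ofReal t)

attribute [instance] PValueModel.mΩ

/-- The FDR of the BH procedure at level `α` on p-values distributed as `P`. -/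
noncomputable def PValueModel.FDR (P : PValueModel) (α : ℝ) : ℝ :=
  ∫ ω, bhFDP α P.N₀ (fun i => P.p i ω) ∂P.μ

/-- The p-value distribution element induced by the null subvector of `P`, regarded
as an element in which all coordinates are null. -/
noncomputable def PValueModel.nulls (P : PValueModel) : PValueModel where
  n := P.N₀.card
  Ω := P.Ω
  μ := P.μ
  prob := P.prob
  p := fun i ω => P.p (P.N₀.orderEmbOfFin rfl i) ω
  meas := fun i => P.meas _
  range := fun i ω => P.range _ ω
  N₀ := Finset.univ
  superuniform := fun i _ t ht =>
    P.superuniform _ (Finset.orderEmbOfFin_mem P.N₀ rfl i) t ht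

/-- A class of p-value distribution elements is FDR-consistent if
`limsup_{α→0} sup_{P ∈ 𝒫} FDR(α; P) = 0`, i.e. the FDR of the BH procedure tends
to zero as `α → 0`, uniformly over the class. -/
def FDRConsistent (cl : Set PValueModel) : Prop :=
  ∀ ε : ℝ, 0 < ε → ∃ δ : ℝ, 0 < δ ∧
    ∀ α : ℝ, 0 < α → α < δ → ∀ P ∈ cl, P.FDR α ≤ ε

section BenjaminiHochberg

variable {ι : Type*} [Fintype ι]

theorem bhNumRejections_le_card (α : ℝ) (p : ι → ℝ) :
    bhNumRejections α p ≤
      #{i | p i ≤ α * (bhNumRejections α p : ℝ) / (Fintype.card ι : ℝ)} :=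
  Nat.findGreatest_spec
    (P := fun j => j ≤ #{i | p i ≤ α * (j : ℝ) / (Fintype.card ι : ℝ)})
    (Nat.zero_le _) (Nat.zero_le _)

theorem le_bhNumRejections {α : ℝ} {p : ι → ℝ} {j : ℕ}
    (h : j ≤ #{i | p i ≤ α * (j : ℝ) / (Fintype.card ι : ℝ)}) :
    j ≤ bhNumRejections α p :=
  Nat.le_findGreatest
    (P := fun j => j ≤ #{i | p i ≤ α * (j : ℝ) / (Fintype.card ι : ℝ)})
    (h.trans (card_le_univ _)) h

/-- The number of p-values below the rejection threshold is at most the number of rejections. -/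
theorem card_le_bhNumRejections {α : ℝ} (hα : 0 ≤ α) (p : ι → ℝ) :
    #{i | p i ≤ α * (bhNumRejections α p : ℝ) / (Fintype.card ι : ℝ)} ≤
      bhNumRejections α p := by
  apply le_bhNumRejections
  have h := bhNumRejections_le_card α p
  refine card_le_card (monotone_filter_right _ fun i _ hi => hi.trans ?_)
  gcongr

theorem bhFDP_nonneg (α : ℝ) (N₀ : Finset ι) (p : ι → ℝ) : 0 ≤ bhFDP α N₀ p := by
  unfold bhFDP
  positivity

theorem bhFDP_le_one {α : ℝ} (hα : 0 ≤ α) (N₀ : Finset ι) (p : ι → ℝ) :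
    bhFDP α N₀ p ≤ 1 := by
  unfold bhFDP
  refine div_le_one_of_le₀ (Nat.cast_le.2 ?_) (Nat.cast_nonneg _)
  exact (card_le_card (filter_subset_filter _ (subset_univ N₀))).trans
    ((card_le_bhNumRejections hα p).trans (le_max_left _ _))

theorem one_le_bhFDP_univ {α : ℝ} {p : ι → ℝ} (h : 1 ≤ bhNumRejections α p) :
    1 ≤ bhFDP α univ p := by
  unfold bhFDP
  rw [max_eq_left h, one_le_div (by exact_mod_cast h)]
  exact_mod_cast bhNumRejections_le_card α p

theorem measurable_bhFDP {Ω : Type*} [MeasurableSpace Ω] (α : ℝ) (N₀ : Finset ι)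
    {p : ι → Ω → ℝ} (hp : ∀ i, Measurable (p i)) :
    Measurable fun ω => bhFDP α N₀ (fun i => p i ω) := by
  have hcard (s : Finset ι) {t : Ω → ℝ} (ht : Measurable t) :
      Measurable fun ω => #{i ∈ s | p i ω ≤ t ω} := by
    simp only [card_filter]
    exact Finset.measurable_sum _ fun i _ =>
      Measurable.ite (measurableSet_le (hp i) ht) measurable_const measurable_const
  have hR : Measurable fun ω => bhNumRejections α (fun i => p i ω) :=
    measurable_findGreatest fun k _ =>
      measurableSet_le measurable_const (hcard univ measurable_const)
  have hR' : Measurable fun ω => (bhNumRejections α (fun i => p i ω) : ℝ) :=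
    measurable_from_top.comp hR
  have hV := hcard N₀ ((hR'.const_mul α).div_const (Fintype.card ι : ℝ))
  exact (measurable_from_top.comp hV).div
    ((measurable_from_top (f := fun k : ℕ => ((max k 1 : ℕ) : ℝ))).comp hR)

/-- If the FDP exceeds `ε` at level `α`, then BH applied to the nulls alone rejects something
at level `α / ε`. -/
theorem bhFDP_le_add_bhFDP_nulls {κ : Type*} [Fintype κ] (e : κ ↪ ι) {N₀ : Finset ι}
    (he : univ.map e = N₀) {α ε : ℝ} (hα : 0 ≤ α) (hε : 0 < ε) (p : ι → ℝ) :
    bhFDP α N₀ p ≤ ε + bhFDP (α / ε) univ (fun k => p (e k)) := by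
  rcases le_or_gt (bhFDP α N₀ p) ε with h | h
  · linarith [bhFDP_nonneg (α / ε) univ (fun k => p (e k))]
  suffices 1 ≤ bhFDP (α / ε) univ (fun k => p (e k)) by
    linarith [bhFDP_le_one hα N₀ p]
  apply one_le_bhFDP_univ
  unfold bhFDP at h
  set R := bhNumRejections α p
  have hV : #{i ∈ N₀ | p i ≤ α * (R : ℝ) / (Fintype.card ι : ℝ)} =
      #{k | p (e k) ≤ α * (R : ℝ) / (Fintype.card ι : ℝ)} := by
    rw [← he, filter_map, card_map]
    rfl
  rw [hV] at h
  set V := #{k | p (e k) ≤ α * (R : ℝ) / (Fintype.card ι : ℝ)} with hVdef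
  rw [lt_div_iff₀ (by positivity)] at h
  have hRV : (R : ℝ) ≤ V / ε := by
    rw [le_div_iff₀' hε]
    refine le_trans ?_ h.le
    gcongr
    exact le_max_left _ _
  have hVpos : 0 < V := by
    rw [← Nat.cast_pos (α := ℝ)]
    exact lt_of_le_of_lt (by positivity) h
  have hκ : 0 < Fintype.card κ := hVpos.trans_le (card_le_univ _)
  have hκι : Fintype.card κ ≤ Fintype.card ι := Fintype.card_le_of_embedding e
  refine le_trans hVpos (le_bhNumRejections ?_)
  rw [hVdef]
  refine card_le_card (monotone_filter_right _ fun k _ hk => hk.trans ?_)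
  rw [← hVdef]
  calc α * (R : ℝ) / (Fintype.card ι : ℝ)
      ≤ α * (V / ε) / (Fintype.card κ : ℝ) := by gcongr
    _ = α / ε * V / (Fintype.card κ : ℝ) := by ring

end BenjaminiHochberg

theorem PValueModel.FDR_le_add_FDR_nulls (P : PValueModel) {α ε : ℝ} (hα : 0 ≤ α)
    (hε : 0 < ε) : P.FDR α ≤ ε + P.nulls.FDR (α / ε) := by
  have := P.prob
  let q : Fin P.N₀.card → P.Ω → ℝ := fun i => P.p (P.N₀.orderEmbOfFin rfl i)
  have hint : Integrable (fun ω => bhFDP (α / ε) univ (fun i => q i ω)) P.μ := by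
    refine Integrable.of_bound
      (measurable_bhFDP _ _ fun i => P.meas _).aestronglyMeasurable 1 (.of_forall fun ω => ?_)
    rw [Real.norm_of_nonneg (bhFDP_nonneg _ _ _)]
    exact bhFDP_le_one (by positivity) _ _
  calc P.FDR α ≤ ∫ ω, (ε + bhFDP (α / ε) univ (fun i => q i ω)) ∂P.μ :=
        integral_mono_of_nonneg (.of_forall fun ω => bhFDP_nonneg _ _ _)
          ((integrable_const ε).add hint) (.of_forall fun ω =>
            bhFDP_le_add_bhFDP_nulls (P.N₀.orderEmbOfFin rfl).toEmbedding
              (P.N₀.map_orderEmbOfFin_univ rfl) hα hε fun i => P.p i ω)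
    _ = ε + P.nulls.FDR (α / ε) := by
        rw [integral_add (integrable_const ε) hint, integral_const, probReal_univ, one_smul]
        rfl

/-- **FDR consistency is determined by the nulls.** If the class of null-induced
distributions `𝒫₀ = {P₀ : P ∈ 𝒫}` is FDR-consistent, then `𝒫` is FDR-consistent. -/
theorem fdr_consistency_from_nulls (cl : Set PValueModel)
    (h0 : FDRConsistent (PValueModel.nulls '' cl)) :
    FDRConsistent cl := by
  intro ε hε
  obtain ⟨δ, hδ, h⟩ := h0 (ε / 2) (half_pos hε)
  refine ⟨δ * (ε / 2), by positivity, fun α hα hαδ P hP => ?_⟩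
  have hnulls := h (α / (ε / 2)) (by positivity) ((div_lt_iff₀ (half_pos hε)).2 hαδ)
    P.nulls (Set.mem_image_of_mem _ hP)
  linarith [P.FDR_le_add_FDR_nulls hα.le (half_pos hε)]
end

section
/- (Simes lemma under PRDN.) Assume the p-values satisfy the PRDN property and the null p-values are super-uniform. Then the Simes p-value on the nulls, min_{1≤j≤n_0} n_0·p^null_(j)/j, is stochastically larger than or equal to a uniform random variable on (0,1); equivalently, P(min_{1≤j≤n_0} n_0·p^null_(j)/j ≤ x) ≤ x for every x ∈ (0,1). -/
open MeasureTheory Finset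

attribute [local instance] Classical.propDecidable

/-- An increasing subset `D` of the cube `[0,1]^ι`: membership is preserved when
coordinates increase (while staying at most 1). -/
def IsIncreasingSet {ι : Type*} (D : Set (ι → ℝ)) : Prop :=
  (∀ x ∈ D, ∀ i, x i ∈ Set.Icc (0:ℝ) 1) ∧
    ∀ x ∈ D, ∀ y : ι → ℝ, (∀ i, x i ≤ y i) → (∀ i, y i ≤ 1) → y ∈ D

/-- Positive regression dependence of the random vector `q`: for every increasing set
`D` and every coordinate `i`, the conditional probability `P(q ∈ D ∣ q i ≤ t)` is
non-decreasing in `t ∈ (0,1]` (stated in cross-multiplied form, so that no division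
by a possibly vanishing probability occurs). -/
def PRD {Ω : Type*} [MeasurableSpace Ω] {ι : Type*} (μ : Measure Ω) (q : ι → Ω → ℝ) : Prop :=
  ∀ D : Set (ι → ℝ), IsIncreasingSet D → ∀ i : ι, ∀ s t : ℝ, 0 < s → s ≤ t → t ≤ 1 →
    μ ({ω | (fun j => q j ω) ∈ D} ∩ {ω | q i ω ≤ s}) * μ {ω | q i ω ≤ t} ≤
      μ ({ω | (fun j => q j ω) ∈ D} ∩ {ω | q i ω ≤ t}) * μ {ω | q i ω ≤ s}

/-- PRDN (positive regression dependence within nulls): the subvector of null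
p-values `(p i)_{i ∈ N₀}` satisfies PRD. -/
def PRDN {Ω : Type*} [MeasurableSpace Ω] {n : ℕ} (μ : Measure Ω)
    (N₀ : Finset (Fin n)) (p : Fin n → Ω → ℝ) : Prop :=
  PRD μ (fun (i : {i // i ∈ N₀}) ω => p i.1 ω)

/-- `orderStat s p j` is the `j`-th smallest value (1-indexed, for `1 ≤ j ≤ |s|`)
among the family `(p i)_{i ∈ s}`: the least `c` such that at least `j` of the values
are at most `c`. -/
noncomputable def orderStat {ι : Type*} (s : Finset ι) (p : ι → ℝ) (j : ℕ) : ℝ :=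
  sInf {c : ℝ | j ≤ (s.filter fun i => p i ≤ c).card}

/-- The Simes statistic `min_{1 ≤ j ≤ |s|} |s| ⋅ p_(j) / j` of the family
`(p i)_{i ∈ s}`. -/
noncomputable def simesStat {ι : Type*} (s : Finset ι) (p : ι → ℝ) : ℝ :=
  ⨅ j : {j : ℕ // 1 ≤ j ∧ j ≤ s.card}, (s.card : ℝ) * orderStat s p j.1 / (j.1 : ℝ)

/-- The number of BH rejections is antitone in the vector of p-values. -/
lemma bhNumRejections_antitone {ι : Type*} [Fintype ι] (α : ℝ) :
    Antitone (bhNumRejections (ι := ι) α) := by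
  intro u v huv
  unfold bhNumRejections
  refine Nat.findGreatest_mono_left (fun j hj => hj.trans (Finset.card_le_card ?_)) _
  intro i hi
  simp only [Finset.mem_filter, Finset.mem_univ, true_and] at hi ⊢
  exact (huv i).trans hi

lemma bhNumRejections_le_card_s8 {ι : Type*} [Fintype ι] (α : ℝ) (v : ι → ℝ) :
    bhNumRejections α v ≤ Fintype.card ι :=
  Nat.findGreatest_le _

/-- The BH procedure at a nonnegative level rejects exactly the p-values below its
rejection threshold. -/
lemma card_filter_le_eq_bhNumRejections {ι : Type*} [Fintype ι] {α : ℝ} (hα : 0 ≤ α)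
    (v : ι → ℝ) (hv : bhNumRejections α v ≠ 0) :
    (Finset.univ.filter fun i =>
      v i ≤ α * (bhNumRejections α v : ℝ) / (Fintype.card ι : ℝ)).card =
        bhNumRejections α v := by
  let P : ℕ → Prop := fun j =>
    j ≤ (Finset.univ.filter fun i => v i ≤ α * (j : ℝ) / (Fintype.card ι : ℝ)).card
  set k := bhNumRejections α v with hk
  have hle : k ≤ (Finset.univ.filter fun i => v i ≤ α * (k : ℝ) / (Fintype.card ι : ℝ)).card :=
    Nat.findGreatest_of_ne_zero (P := P) hk.symm hv
  refine le_antisymm ?_ hle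
  by_contra! hlt
  have hcard : k + 1 ≤ Fintype.card ι := (Nat.succ_le_of_lt hlt).trans (Finset.card_le_univ _)
  refine Nat.findGreatest_is_greatest (P := P) (k := k + 1) (Nat.lt_succ_self k) hcard
    ((Nat.succ_le_of_lt hlt).trans (Finset.card_le_card ?_))
  intro i hi
  simp only [Finset.mem_filter, Finset.mem_univ, true_and] at hi ⊢
  refine hi.trans ?_
  push_cast
  gcongr
  linarith

lemma measurable_bhNumRejections {Ω : Type*} [MeasurableSpace Ω] {ι : Type*} [Fintype ι]
    (α : ℝ) {q : ι → Ω → ℝ} (hq : ∀ i, Measurable (q i)) :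
    Measurable fun ω => bhNumRejections α fun i => q i ω := by
  unfold bhNumRejections
  refine measurable_findGreatest fun k _ => ?_
  simp only [Finset.card_filter]
  refine measurableSet_le measurable_const (Finset.measurable_sum _ fun i _ => ?_)
  exact Measurable.ite (measurableSet_le (hq i) measurable_const) measurable_const
    measurable_const

lemma isIncreasingSet_bhNumRejections_le {ι : Type*} [Fintype ι] (α : ℝ) (k : ℕ) :
    IsIncreasingSet {v : ι → ℝ | (∀ i, v i ∈ Set.Icc (0 : ℝ) 1) ∧ bhNumRejections α v ≤ k} :=
  ⟨fun _ hv => hv.1, fun _ hv _ hvw hw =>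
    ⟨fun i => ⟨(hv.1 i).1.trans (hvw i), hw i⟩, (bhNumRejections_antitone α hvw).trans hv.2⟩⟩

/-- If each point of `S` lies in exactly `k` of the sets `E i`, then the measures of the
sets `S ∩ E i` add up to `k` times the measure of `S`. -/
lemma sum_measureReal_inter_eq_mul {Ω : Type*} [MeasurableSpace Ω] {μ : Measure Ω}
    [IsFiniteMeasure μ] {ι : Type*} [Fintype ι] {S : Set Ω} (hS : MeasurableSet S)
    {E : ι → Set Ω} (hE : ∀ i, MeasurableSet (E i)) {k : ℕ}
    (hk : ∀ ω ∈ S, (Finset.univ.filter fun i => ω ∈ E i).card = k) :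
    ∑ i, μ.real (S ∩ E i) = k * μ.real S := by
  have hint : ∀ i, Integrable ((S ∩ E i).indicator fun _ => (1 : ℝ)) μ := fun i =>
    (integrable_const 1).indicator (hS.inter (hE i))
  calc ∑ i, μ.real (S ∩ E i)
      = ∑ i, ∫ ω, (S ∩ E i).indicator (fun _ => (1 : ℝ)) ω ∂μ := by
        refine Finset.sum_congr rfl fun i _ => ?_
        rw [integral_indicator_const _ (hS.inter (hE i)), smul_eq_mul, mul_one]
    _ = ∫ ω, ∑ i, (S ∩ E i).indicator (fun _ => (1 : ℝ)) ω ∂μ :=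
        (integral_finsetSum _ fun i _ => hint i).symm
    _ = ∫ ω, S.indicator (fun _ => (k : ℝ)) ω ∂μ := by
        refine integral_congr_ae (Filter.Eventually.of_forall fun ω => ?_)
        by_cases hω : ω ∈ S
        · simp only [Set.indicator_apply, Set.mem_inter_iff, hω, true_and, if_true]
          rw [← hk ω hω, Finset.card_filter]
          push_cast
          rfl
        · simp [hω]
    _ = k * μ.real S := by
        rw [integral_indicator_const _ hS, smul_eq_mul, mul_comm]

/-- Under PRD, the contribution of a single super-uniform p-value to the false discovery
rate of the BH procedure at level `x`, when all hypotheses are null. -/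
lemma PRD.sum_measureReal_div_le {Ω : Type*} [MeasurableSpace Ω] {μ : Measure Ω}
    [IsProbabilityMeasure μ] {ι : Type*} [Fintype ι] {q : ι → Ω → ℝ} (hPRD : PRD μ q)
    (hmeas : ∀ i, Measurable (q i)) (hrange : ∀ i ω, q i ω ∈ Set.Icc (0 : ℝ) 1) (i : ι)
    (hnull : ∀ t ∈ Set.Icc (0 : ℝ) 1, μ.real {ω | q i ω ≤ t} ≤ t)
    {x : ℝ} (hx : 0 < x) (hx1 : x ≤ 1) :
    ∑ k ∈ Finset.Icc 1 (Fintype.card ι),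
      μ.real ({ω | bhNumRejections x (fun j => q j ω) = k} ∩
        {ω | q i ω ≤ x * (k : ℝ) / (Fintype.card ι : ℝ)}) / k ≤ x / Fintype.card ι := by
  set m := Fintype.card ι with hm
  have hmpos : (0 : ℝ) < m := by exact_mod_cast Fintype.card_pos_iff.mpr ⟨i⟩
  set R : Ω → ℕ := fun ω => bhNumRejections x (fun j => q j ω) with hR
  have hRmeas : Measurable R := measurable_bhNumRejections x hmeas
  set E : ℕ → Set Ω := fun k => {ω | q i ω ≤ x * (k : ℝ) / (m : ℝ)} with hE
  have hEmono : ∀ k, E k ⊆ E (k + 1) := fun k ω hω => by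
    have hω' : q i ω ≤ x * (k : ℝ) / (m : ℝ) := hω
    refine hω'.trans ?_
    push_cast
    gcongr
    linarith
  have hF : ∀ k ≤ m, μ.real (E k) ≤ x * k / m := fun k hk => by
    have hkm : (k : ℝ) ≤ m := by exact_mod_cast hk
    refine hnull _ ⟨by positivity, ?_⟩
    rw [div_le_one hmpos]
    nlinarith
  set a : ℕ → ℝ := fun k => μ.real ({ω | R ω ≤ k} ∩ E k) / μ.real (E k) with ha
  have ha1 : ∀ k, a k ≤ 1 := fun k =>
    div_le_one_of_le₀ (measureReal_mono Set.inter_subset_right) measureReal_nonneg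
  have hprd : ∀ k, k + 1 ≤ m →
      a k ≤ μ.real ({ω | R ω ≤ k} ∩ E (k + 1)) / μ.real (E (k + 1)) := by
    intro k hk
    rcases (measureReal_nonneg (μ := μ) (s := E k)).eq_or_lt with h0 | hpos
    · simp only [ha, ← h0, div_zero]
      positivity
    have hkpos : 0 < k := by
      rcases Nat.eq_zero_or_pos k with rfl | h
      · have := hF 0 (Nat.zero_le _)
        simp only [Nat.cast_zero, mul_zero, zero_div] at this
        exact absurd this (not_le.mpr hpos)
      · exact h
    have hkm : ((k + 1 : ℕ) : ℝ) ≤ m := by exact_mod_cast hk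
    have hset : {ω | (fun j => q j ω) ∈ {v : ι → ℝ | (∀ j, v j ∈ Set.Icc (0 : ℝ) 1) ∧
        bhNumRejections x v ≤ k}} = {ω | R ω ≤ k} := by
      ext ω
      simp only [Set.mem_ofPred_eq, hR]
      exact and_iff_right fun j => hrange j ω
    have key := hPRD _ (isIncreasingSet_bhNumRejections_le x k) i (x * (k : ℝ) / m)
      (x * ((k + 1 : ℕ) : ℝ) / m) (by positivity) (by push_cast; gcongr; linarith)
      (by rw [div_le_one hmpos]; nlinarith [(Nat.cast_nonneg (k + 1) : (0 : ℝ) ≤ (k + 1 : ℕ))])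
    rw [hset] at key
    have key' := ENNReal.toReal_mono (by finiteness) key
    rw [ENNReal.toReal_mul, ENNReal.toReal_mul] at key'
    exact (div_le_div_iff₀ hpos (hpos.trans_le (measureReal_mono (hEmono k)))).mpr key'
  have hstep : ∀ K ≤ m, ∑ k ∈ Finset.Icc 1 K, μ.real ({ω | R ω = k} ∩ E k) / k ≤
      x / m * a K := by
    intro K
    induction K with
    | zero =>
      intro _
      simp only [Finset.Icc_eq_empty_of_lt one_pos, Finset.sum_empty]
      positivity
    | succ K ih =>
      intro hK
      rw [Finset.sum_Icc_succ_top (by omega)]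
      have hsplit : μ.real ({ω | R ω = K + 1} ∩ E (K + 1)) =
          μ.real ({ω | R ω ≤ K + 1} ∩ E (K + 1)) - μ.real ({ω | R ω ≤ K} ∩ E (K + 1)) := by
        have hEm : MeasurableSet (E (K + 1)) := measurableSet_le (hmeas i) measurable_const
        rw [eq_sub_iff_add_eq, ← measureReal_union]
        · congr 1
          ext ω
          simp only [Set.mem_union, Set.mem_inter_iff, Set.mem_ofPred_eq]
          rw [← or_and_right]
          exact and_congr_left fun _ => by omega
        · refine Set.disjoint_left.mpr fun ω h₁ h₂ => ?_
          have h₁' : R ω = K + 1 := h₁.1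
          have h₂' : R ω ≤ K := h₂.1
          omega
        · exact (measurableSet_le hRmeas measurable_const).inter hEm
      have hterm : μ.real ({ω | R ω = K + 1} ∩ E (K + 1)) / ((K + 1 : ℕ) : ℝ) ≤
          x / m * (μ.real ({ω | R ω = K + 1} ∩ E (K + 1)) / μ.real (E (K + 1))) := by
        have hle : μ.real ({ω | R ω = K + 1} ∩ E (K + 1)) ≤ μ.real (E (K + 1)) :=
          measureReal_mono Set.inter_subset_right
        rcases (measureReal_nonneg (μ := μ) (s := E (K + 1))).eq_or_lt with h0 | hpos
        · have : μ.real ({ω | R ω = K + 1} ∩ E (K + 1)) = 0 :=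
            le_antisymm (h0 ▸ hle) measureReal_nonneg
          simp [this]
        · have hFK := hF (K + 1) hK
          have hKpos : (0 : ℝ) < (K + 1 : ℕ) := by positivity
          rw [mul_div_assoc', div_le_div_iff₀ hKpos hpos]
          calc _ ≤ μ.real ({ω | R ω = K + 1} ∩ E (K + 1)) * (x * (K + 1 : ℕ) / m) := by gcongr
            _ = _ := by ring
      have hxm : 0 ≤ x / m := by positivity
      have h₁ := mul_le_mul_of_nonneg_left (hprd K hK) hxm
      have h₂ := ih (by omega)
      have h₃ : x / m * (μ.real ({ω | R ω = K + 1} ∩ E (K + 1)) / μ.real (E (K + 1))) =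
          x / m * a (K + 1) -
            x / m * (μ.real ({ω | R ω ≤ K} ∩ E (K + 1)) / μ.real (E (K + 1))) := by
        rw [hsplit, sub_div, mul_sub]
      linarith
  calc _ ≤ x / m * a m := hstep m le_rfl
    _ ≤ x / m * 1 := by gcongr; exact ha1 m
    _ = x / m := mul_one _

/-- Under PRD and super-uniformity of all p-values, the BH procedure at level `x` makes a
rejection with probability at most `x`. -/
lemma PRD.measureReal_bhNumRejections_ne_zero_le {Ω : Type*} [MeasurableSpace Ω]
    {μ : Measure Ω} [IsProbabilityMeasure μ] {ι : Type*} [Fintype ι] {q : ι → Ω → ℝ}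
    (hPRD : PRD μ q) (hmeas : ∀ i, Measurable (q i))
    (hrange : ∀ i ω, q i ω ∈ Set.Icc (0 : ℝ) 1)
    (hnull : ∀ i, ∀ t ∈ Set.Icc (0 : ℝ) 1, μ.real {ω | q i ω ≤ t} ≤ t)
    {x : ℝ} (hx : 0 < x) (hx1 : x ≤ 1) :
    μ.real {ω | bhNumRejections x (fun i => q i ω) ≠ 0} ≤ x := by
  set m := Fintype.card ι with hm
  have hRmeas := measurable_bhNumRejections x hmeas
  have hcover : {ω | bhNumRejections x (fun i => q i ω) ≠ 0} ⊆
      ⋃ k ∈ Finset.Icc 1 m, {ω | bhNumRejections x (fun i => q i ω) = k} := fun ω hω => by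
    simp only [Set.mem_iUnion, Finset.mem_Icc, Set.mem_ofPred_eq, exists_prop]
    exact ⟨_, ⟨Nat.one_le_iff_ne_zero.mpr hω, bhNumRejections_le_card_s8 _ _⟩, rfl⟩
  calc μ.real {ω | bhNumRejections x (fun i => q i ω) ≠ 0}
      ≤ ∑ k ∈ Finset.Icc 1 m, μ.real {ω | bhNumRejections x (fun i => q i ω) = k} :=
        (measureReal_mono hcover (measure_ne_top _ _)).trans (measureReal_biUnion_finset_le _ _)
    _ = ∑ k ∈ Finset.Icc 1 m, ∑ i, μ.real ({ω | bhNumRejections x (fun j => q j ω) = k} ∩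
          {ω | q i ω ≤ x * (k : ℝ) / (m : ℝ)}) / k := by
        refine Finset.sum_congr rfl fun k hk => ?_
        have hk0 : k ≠ 0 := Nat.one_le_iff_ne_zero.mp (Finset.mem_Icc.mp hk).1
        rw [← Finset.sum_div, sum_measureReal_inter_eq_mul (k := k)
          (S := {ω | bhNumRejections x (fun i => q i ω) = k}) (hRmeas (measurableSet_singleton k))
          (fun i => measurableSet_le (hmeas i) measurable_const)]
        · rw [mul_div_cancel_left₀ _ (Nat.cast_ne_zero.mpr hk0)]
        · rintro ω rfl
          exact card_filter_le_eq_bhNumRejections hx.le _ hk0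
    _ = ∑ i, ∑ k ∈ Finset.Icc 1 m, μ.real ({ω | bhNumRejections x (fun j => q j ω) = k} ∩
          {ω | q i ω ≤ x * (k : ℝ) / (m : ℝ)}) / k := Finset.sum_comm
    _ ≤ ∑ _i : ι, x / m := Finset.sum_le_sum fun i _ =>
        hPRD.sum_measureReal_div_le hmeas hrange i (hnull i) hx hx1
    _ = m * (x / m) := by rw [Finset.sum_const, Finset.card_univ, nsmul_eq_mul]
    _ ≤ x := by
        rcases eq_or_ne (m : ℝ) 0 with h | h
        · simpa [h] using hx.le
        · rw [mul_div_cancel₀ _ h]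

/-- If the `j`-th order statistic is at most `t`, then at least `j` values are at most `t`. -/
lemma le_card_filter_of_orderStat_le {ι : Type*} {s : Finset ι} {p : ι → ℝ} {j : ℕ}
    (hj : j ≤ s.card) {t : ℝ} (ht : orderStat s p j ≤ t) :
    j ≤ (s.filter fun i => p i ≤ t).card := by
  have hev : ∀ᶠ c in nhdsWithin t (Set.Ioi t), ∀ i ∈ s, p i ≤ c → p i ≤ t := by
    rw [Filter.eventually_all_finset]
    intro i _
    rcases le_or_gt (p i) t with h | h
    · exact Filter.Eventually.of_forall fun _ _ => h
    · filter_upwards [mem_nhdsWithin_of_mem_nhds (Iio_mem_nhds h)] with c hc hpc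
      exact absurd hpc (not_le.mpr hc)
  obtain ⟨c, hc, htc⟩ := (hev.and self_mem_nhdsWithin).exists
  have hne : {c : ℝ | j ≤ (s.filter fun i => p i ≤ c).card}.Nonempty := by
    obtain ⟨M, hM⟩ := (s.image p).bddAbove
    refine ⟨M, ?_⟩
    have hall : (s.filter fun i => p i ≤ M) = s :=
      Finset.filter_true_of_mem fun i hi => hM (Finset.mem_coe.mpr (Finset.mem_image_of_mem p hi))
    simpa only [Set.mem_ofPred_eq, hall] using hj
  obtain ⟨d, hd, hdc⟩ := exists_lt_of_csInf_lt hne (ht.trans_lt htc)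
  refine le_trans hd (Finset.card_le_card fun i hi => ?_)
  rw [Finset.mem_filter] at hi ⊢
  exact ⟨hi.1, hc i hi.1 (hi.2.trans hdc.le)⟩

/-- If the Simes statistic is at most `x`, then the BH procedure at level `x` makes a
rejection. -/
lemma bhNumRejections_ne_zero_of_simesStat_le {ι : Type*} {s : Finset ι} (hs : 0 < s.card)
    {p : ι → ℝ} {x : ℝ} (h : simesStat s p ≤ x) :
    bhNumRejections x (fun i : {i // i ∈ s} => p i.1) ≠ 0 := by
  have : Nonempty {j : ℕ // 1 ≤ j ∧ j ≤ s.card} := ⟨⟨1, le_rfl, hs⟩⟩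
  have : Finite {j : ℕ // 1 ≤ j ∧ j ≤ s.card} := (Set.finite_Icc 1 s.card).to_subtype
  obtain ⟨⟨j, hj1, hjs⟩, hj⟩ := exists_eq_ciInf_of_finite
    (f := fun j : {j : ℕ // 1 ≤ j ∧ j ≤ s.card} => (s.card : ℝ) * orderStat s p j.1 / (j.1 : ℝ))
  have hjx : (s.card : ℝ) * orderStat s p j / (j : ℝ) ≤ x := hj.trans_le h
  have hjpos : (0 : ℝ) < j := by exact_mod_cast hj1
  have hspos : (0 : ℝ) < s.card := by exact_mod_cast hs
  rw [div_le_iff₀ hjpos, mul_comm, ← le_div_iff₀ hspos] at hjx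
  have hcount := le_card_filter_of_orderStat_le hjs hjx
  refine Nat.one_le_iff_ne_zero.mp
    (hj1.trans (Nat.le_findGreatest (by rwa [Fintype.card_coe]) ?_))
  rw [Fintype.card_coe]
  refine hcount.trans (le_of_eq ?_)
  rw [← Finset.card_map (Function.Embedding.subtype fun i => i ∈ s)]
  congr 1
  ext i
  simp [and_comm]

/-- **Simes lemma under PRDN.** If the p-values satisfy the PRDN property and the
null p-values are super-uniform, then the Simes p-value on the nulls,
`min_{1 ≤ j ≤ n₀} n₀ ⋅ p^null_(j) / j`, is stochastically larger than or equal to a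
uniform random variable on `(0,1)`: `P(simes ≤ x) ≤ x` for every `x ∈ (0,1)`. -/
theorem simes_superuniform_of_PRDN
    {Ω : Type*} [MeasurableSpace Ω] (μ : Measure Ω) [IsProbabilityMeasure μ]
    {n : ℕ} (hn : 0 < n) (p : Fin n → Ω → ℝ)
    (hmeas : ∀ i, Measurable (p i))
    (hrange : ∀ i ω, p i ω ∈ Set.Icc (0:ℝ) 1)
    (N₀ : Finset (Fin n)) (hN₀ : 0 < N₀.card)
    (hnull : ∀ i ∈ N₀, ∀ t ∈ Set.Icc (0:ℝ) 1, μ {ω | p i ω ≤ t} ≤ ENNReal.ofReal t)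
    (hPRDN : PRDN μ N₀ p)
    {x : ℝ} (hx : 0 < x) (hx1 : x < 1) :
    μ {ω | simesStat N₀ (fun i => p i ω) ≤ x} ≤ ENNReal.ofReal x := by
  have hreal : ∀ i : {i // i ∈ N₀}, ∀ t ∈ Set.Icc (0 : ℝ) 1, μ.real {ω | p i.1 ω ≤ t} ≤ t :=
    fun i t ht => ENNReal.toReal_le_of_le_ofReal ht.1 (hnull i.1 i.2 t ht)
  have hbh := PRD.measureReal_bhNumRejections_ne_zero_le hPRDN (fun i => hmeas i.1)
    (fun i => hrange i.1) hreal hx hx1.le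
  calc μ {ω | simesStat N₀ (fun i => p i ω) ≤ x}
      ≤ μ {ω | bhNumRejections x (fun i : {i // i ∈ N₀} => p i.1 ω) ≠ 0} :=
        measure_mono fun _ hω => bhNumRejections_ne_zero_of_simesStat_le hN₀ hω
    _ = ENNReal.ofReal (μ.real {ω | bhNumRejections x (fun i : {i // i ∈ N₀} => p i.1 ω) ≠ 0}) :=
        (ofReal_measureReal (measure_ne_top _ _)).symm
    _ ≤ ENNReal.ofReal x := ENNReal.ofReal_le_ofReal hbh
end

section
/- (Deterministic FDP bound for compliant procedures.) For any realization of the p-values and any multiple testing procedure compliant at level α ∈ (0,1), the false discovery proportion satisfies FDP ≤ min{ max_{1≤j≤n_0} j/⌈n·p^null_(j)/α⌉, 1 }, where p^null_(1) ≤ ⋯ ≤ p^null_(n_0) are the ordered null p-values and ⌈·⌉ is the ceiling function. -/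
open MeasureTheory Finset

attribute [local instance] Classical.propDecidable

/-- False discovery proportion `V / max{R,1}` of a multiple testing procedure with
rejection set `Rset`, where `N₀` is the set of true null hypotheses. -/
noncomputable def procFDP {ι : Type*} (N₀ Rset : Finset ι) : ℝ :=
  ((Rset ∩ N₀).card : ℝ) / ((max Rset.card 1 : ℕ) : ℝ)

/-- A rejection set `Rset` is compliant at level `α` if every rejected p-value `p j`
satisfies `p j ≤ α ⋅ |Rset| / n`. -/
def IsCompliant {ι : Type*} [Fintype ι] (α : ℝ) (p : ι → ℝ) (Rset : Finset ι) : Prop :=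
  ∀ j ∈ Rset, p j ≤ α * (Rset.card : ℝ) / (Fintype.card ι : ℝ)

open scoped ENNReal

theorem orderStat_le_of_le_card {ι : Type*} {s : Finset ι} {p : ι → ℝ} {j : ℕ} {c : ℝ}
    (hj : 1 ≤ j) (hp : ∀ i ∈ s, 0 ≤ p i) (h : j ≤ (s.filter fun i => p i ≤ c).card) :
    orderStat s p j ≤ c := by
  refine csInf_le ⟨0, fun d hd => ?_⟩ h
  obtain ⟨i, hi⟩ := Finset.card_pos.mp (lt_of_lt_of_le hj hd)
  rw [Finset.mem_filter] at hi
  exact (hp i hi.1).trans hi.2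

theorem procFDP_eq {ι : Type*} [DecidableEq ι] (N₀ Rset : Finset ι) :
    procFDP N₀ Rset = ((Rset ∩ N₀).card : ℝ) / ((max Rset.card 1 : ℕ) : ℝ) := by
  unfold procFDP
  congr!

theorem procFDP_le_one {ι : Type*} (N₀ Rset : Finset ι) : procFDP N₀ Rset ≤ 1 := by
  refine div_le_one_of_le₀ ?_ (Nat.cast_nonneg _)
  exact_mod_cast (Finset.card_le_card Finset.inter_subset_left).trans (le_max_left _ _)

/-- **Deterministic FDP bound for compliant procedures.** For any realization of the
p-values and any procedure compliant at level `α ∈ (0,1)`, the false discovery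
proportion satisfies `FDP ≤ min{ max_{1 ≤ j ≤ n₀} j/⌈n p^null_(j)/α⌉, 1 }` (stated in
`ℝ≥0∞`, where division by a vanishing ceiling correctly yields `∞`). -/
theorem fdp_bound_compliant
    {n : ℕ} (hn : 0 < n) (p : Fin n → ℝ)
    (hrange : ∀ i, p i ∈ Set.Icc (0:ℝ) 1)
    (N₀ : Finset (Fin n)) (hN₀ : 0 < N₀.card)
    {α : ℝ} (hα : 0 < α) (hα1 : α < 1)
    (Rset : Finset (Fin n)) (hcomp : IsCompliant α p Rset) :
    ENNReal.ofReal (procFDP N₀ Rset) ≤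
      min (⨆ j : {j : ℕ // 1 ≤ j ∧ j ≤ N₀.card},
            (j.1 : ℝ≥0∞) / ((Nat.ceil ((n : ℝ) * orderStat N₀ p j.1 / α) : ℕ) : ℝ≥0∞)) 1 := by
  refine le_min ?_ (ENNReal.ofReal_le_one.mpr (procFDP_le_one N₀ Rset))
  obtain hV | hV := Nat.eq_zero_or_pos (Rset ∩ N₀).card
  · simp [procFDP_eq, hV]
  have hVR : (Rset ∩ N₀).card ≤ Rset.card := Finset.card_le_card Finset.inter_subset_left
  have hR : 0 < Rset.card := hV.trans_le hVR
  have hn' : (0 : ℝ) < n := Nat.cast_pos.mpr hn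
  have hstat : orderStat N₀ p (Rset ∩ N₀).card ≤ α * (Rset.card : ℝ) / n := by
    refine orderStat_le_of_le_card hV (fun i _ => (hrange i).1) (Finset.card_le_card ?_)
    intro i hi
    rw [Finset.mem_inter] at hi
    exact Finset.mem_filter.mpr ⟨hi.2, by simpa using hcomp i hi.1⟩
  have hceil : ⌈(n : ℝ) * orderStat N₀ p (Rset ∩ N₀).card / α⌉₊ ≤ Rset.card := by
    rw [Nat.ceil_le, div_le_iff₀ hα]
    rw [le_div_iff₀ hn'] at hstat
    linarith
  refine le_trans ?_ (le_iSup _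
    ⟨(Rset ∩ N₀).card, hV, Finset.card_le_card Finset.inter_subset_right⟩)
  rw [procFDP_eq, max_eq_left hR, ENNReal.ofReal_div_of_pos (Nat.cast_pos.mpr hR),
    ENNReal.ofReal_natCast, ENNReal.ofReal_natCast]
  exact ENNReal.div_le_div_left (Nat.cast_le.mpr hceil) _
end
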